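/- arXiv:2410.17091 — 2 statements merged into one kernel-verified Lean document; each statement's English description precedes it below -/
import Mathlib

section
/- Let M be an m×n real matrix, let K ≥ 1 be an integer and α > 1 a real number. Let ω⁽¹⁾, …, ω⁽ᴷ⁾ be independent random vectors in ℝⁿ with independent standard Gaussian N(0,1) entries. Then with probability at least 1 − α^{−K}, one has ‖M‖₂ ≤ α √(2/π) · max_{i = 1,…,K} ‖M ω⁽ⁱ⁾‖₂. -/
open Matrix MeasureTheory ProbabilityTheory

/-- The spectral norm of a real matrix: the operator norm of the induced linear map
between Euclidean spaces. -/
noncomputable def specNorm {m n : ℕ} (A : Matrix (Fin m) (Fin n) ℝ) : ℝ :=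
  ‖LinearMap.toContinuousLinearMap (Matrix.toEuclideanLin A)‖

/-- The Euclidean (ℓ²) norm of a real vector. -/
noncomputable def euclNorm {m : ℕ} (v : Fin m → ℝ) : ℝ :=
  Real.sqrt (∑ i, v i ^ 2)

/-- The standard Gaussian small-ball estimate, from the bound `(√(2πv))⁻¹` on the density. -/
lemma sqrt_mul_gaussianReal_abs_lt_le (v : NNReal) {t : ℝ} (ht : 0 ≤ t) :
    √v * (gaussianReal 0 v).real {x | |x| < t} ≤ √(2 / Real.pi) * t := by
  rcases eq_or_ne v 0 with rfl | hv
  · simp only [NNReal.coe_zero, Real.sqrt_zero, zero_mul]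
    positivity
  have hset : {x : ℝ | |x| < t} = Set.Ioo (-t) t := by ext; simp [abs_lt]
  have hpdf (x : ℝ) : gaussianPDFReal 0 v x ≤ (√(2 * Real.pi * v))⁻¹ := by
    rw [gaussianPDFReal]
    refine mul_le_of_le_one_right (by positivity) (Real.exp_le_one_iff.2 ?_)
    rw [neg_div]
    exact neg_nonpos.2 (by positivity)
  have hint : (gaussianReal 0 v).real {x | |x| < t} ≤ (√(2 * Real.pi * v))⁻¹ * (2 * t) := by
    rw [measureReal_def, gaussianReal_apply_eq_integral 0 hv,
      ENNReal.toReal_ofReal (integral_nonneg fun x => gaussianPDFReal_nonneg _ _ _), hset]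
    calc ∫ x in Set.Ioo (-t) t, gaussianPDFReal 0 v x
        ≤ ∫ _ in Set.Ioo (-t) t, (√(2 * Real.pi * v))⁻¹ :=
          setIntegral_mono (integrable_gaussianPDFReal 0 v).integrableOn
            (integrableOn_const (by simp)) hpdf
      _ = (√(2 * Real.pi * v))⁻¹ * (2 * t) := by
          rw [setIntegral_const, Real.volume_real_Ioo_of_le (by linarith), smul_eq_mul]
          ring
  have hv' : 0 < √(v : ℝ) := Real.sqrt_pos.2 (NNReal.coe_pos.2 (pos_iff_ne_zero.2 hv))
  have h2 : 0 < √(2 : ℝ) := by positivity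
  have hpi : 0 < √Real.pi := Real.sqrt_pos.2 Real.pi_pos
  calc √v * (gaussianReal 0 v).real {x | |x| < t}
      ≤ √v * ((√(2 * Real.pi * v))⁻¹ * (2 * t)) := by gcongr
    _ = √(2 / Real.pi) * t := by
      rw [Real.sqrt_mul (by positivity), Real.sqrt_mul (by positivity),
        Real.sqrt_div (by positivity)]
      field_simp
      rw [Real.sq_sqrt (by positivity)]

section InnerProductSpace

variable {E F : Type*} [NormedAddCommGroup E] [InnerProductSpace ℝ E] [FiniteDimensional ℝ E]
  [MeasurableSpace E] [BorelSpace E]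

lemma stdGaussian_map_strongDual (L : StrongDual ℝ E) :
    (stdGaussian E).map L = gaussianReal 0 (‖L‖₊ ^ 2) := by
  rw [IsGaussian.map_eq_gaussianReal L, integral_strongDual_stdGaussian,
    variance_dual_stdGaussian]
  congr
  ext
  simp

/-- For a standard Gaussian vector `x`, `ℙ(‖A x‖ < t) ‖A‖ ≤ √(2/π) t`. -/
lemma stdGaussian_norm_lt_mul_opNorm_le [NormedAddCommGroup F] [InnerProductSpace ℝ F]
    [FiniteDimensional ℝ F] (A : E →L[ℝ] F) {t : ℝ} (ht : 0 ≤ t) :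
    (stdGaussian E).real {x | ‖A x‖ < t} * ‖A‖ ≤ √(2 / Real.pi) * t := by
  have := FiniteDimensional.complete ℝ E
  have := FiniteDimensional.complete ℝ F
  set p := (stdGaussian E).real {x | ‖A x‖ < t}
  have hp : 0 ≤ p := measureReal_nonneg
  have key : ‖p • A.adjoint‖ ≤ √(2 / Real.pi) * t := by
    refine ContinuousLinearMap.opNorm_le_bound _ (by positivity) fun y => ?_
    rcases eq_or_ne y 0 with rfl | hy
    · simp
    have hy' : 0 < ‖y‖ := norm_pos_iff.2 hy
    set L := innerSL ℝ (A.adjoint y)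
    have hsub : {x | ‖A x‖ < t} ⊆ L ⁻¹' {r | |r| < t * ‖y‖} := fun x hx => by
      have h1 : L x = inner ℝ y (A x) := by simp [L, ContinuousLinearMap.adjoint_inner_left]
      simp only [Set.mem_preimage, Set.mem_ofPred_eq, h1] at hx ⊢
      have := abs_real_inner_le_norm y (A x)
      nlinarith
    have hpL : p ≤ (gaussianReal 0 (‖L‖₊ ^ 2)).real {r | |r| < t * ‖y‖} := by
      rw [← stdGaussian_map_strongDual, map_measureReal_apply (by fun_prop)
        (measurableSet_lt (by fun_prop) (by fun_prop))]
      exact measureReal_mono hsub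
    have hL : √((‖L‖₊ ^ 2 : NNReal) : ℝ) = ‖A.adjoint y‖ := by simp [L]
    have := sqrt_mul_gaussianReal_abs_lt_le (‖L‖₊ ^ 2) (t := t * ‖y‖) (by positivity)
    rw [hL] at this
    calc ‖(p • A.adjoint) y‖ = ‖A.adjoint y‖ * p := by
          rw [_root_.smul_apply, norm_smul, Real.norm_of_nonneg hp, mul_comm]
      _ ≤ ‖A.adjoint y‖ * (gaussianReal 0 (‖L‖₊ ^ 2)).real {r | |r| < t * ‖y‖} := by gcongr
      _ ≤ √(2 / Real.pi) * t * ‖y‖ := by linarith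
  rwa [norm_smul, Real.norm_of_nonneg hp, LinearIsometryEquiv.norm_map] at key

end InnerProductSpace

lemma euclNorm_eq_norm_toLp {m : ℕ} (v : Fin m → ℝ) : euclNorm v = ‖WithLp.toLp 2 v‖ := by
  simp [euclNorm, EuclideanSpace.norm_eq]

lemma pi_gaussianReal_euclNorm_mulVec_lt_mul_specNorm_le {m n : ℕ}
    (M : Matrix (Fin m) (Fin n) ℝ) {t : ℝ} (ht : 0 ≤ t) :
    (Measure.pi fun _ : Fin n => gaussianReal 0 1).real {x | euclNorm (M.mulVec x) < t} *
      specNorm M ≤ √(2 / Real.pi) * t := by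
  have := stdGaussian_norm_lt_mul_opNorm_le
    (LinearMap.toContinuousLinearMap (Matrix.toEuclideanLin M)) ht
  rw [← map_pi_eq_stdGaussian, map_measureReal_apply (by fun_prop)
    (measurableSet_lt (by fun_prop) (by fun_prop))] at this
  simpa [euclNorm_eq_norm_toLp, specNorm, Matrix.toLpLin_toLp] using this

/-- Approximate norm estimate via Gaussian sampling: if `ω⁽¹⁾, …, ω⁽ᴷ⁾` are independent
standard Gaussian vectors in `ℝⁿ`, then with probability at least `1 − α^{−K}`,
`‖M‖₂ ≤ α √(2/π) · max_{i} ‖M ω⁽ⁱ⁾‖₂`. -/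
theorem stmt_1 {m n : ℕ} (M : Matrix (Fin m) (Fin n) ℝ)
    (K : ℕ) (hK : 1 ≤ K) (α : ℝ) (hα : 1 < α) :
    1 - (α ^ K)⁻¹ ≤
      (((Measure.pi fun _ : Fin K => Measure.pi fun _ : Fin n => gaussianReal 0 1))
        {ω : Fin K → Fin n → ℝ |
          specNorm M ≤ α * Real.sqrt (2 / Real.pi) *
            Finset.univ.sup' ⟨⟨0, hK⟩, Finset.mem_univ _⟩
              fun i : Fin K => euclNorm (M.mulVec (ω i))}).toReal := by
  have hα0 : 0 < α := by linarith
  set c := Real.sqrt (2 / Real.pi)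
  have hc : 0 < c := Real.sqrt_pos.2 (by positivity)
  have hσ : 0 ≤ specNorm M := norm_nonneg _
  set G := Measure.pi fun _ : Fin n => gaussianReal 0 1
  set S := {ω : Fin K → Fin n → ℝ | specNorm M ≤ α * c *
    Finset.univ.sup' ⟨⟨0, hK⟩, Finset.mem_univ _⟩ fun i : Fin K => euclNorm (M.mulVec (ω i))}
  set B := {x : Fin n → ℝ | euclNorm (M.mulVec x) < specNorm M / (α * c)}
  have hB : G.real B ≤ α⁻¹ := by
    rcases hσ.eq_or_lt with h0 | h0
    · have : B = ∅ := by
        ext x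
        simp [B, ← h0, euclNorm, Real.sqrt_nonneg]
      simp [this, hα0.le]
    · have := pi_gaussianReal_euclNorm_mulVec_lt_mul_specNorm_le M
        (t := specNorm M / (α * c)) (by positivity)
      refine le_of_mul_le_mul_right (this.trans_eq ?_) h0
      change c * _ = _
      field_simp
  have hsub : Sᶜ ⊆ Set.univ.pi fun _ => B := fun ω hω i _ => by
    simp only [S, Set.mem_compl_iff, Set.mem_ofPred_eq, not_le] at hω
    simp only [B, Set.mem_ofPred_eq]
    rw [lt_div_iff₀ (by positivity), mul_comm]
    refine lt_of_le_of_lt ?_ hω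
    gcongr
    exact Finset.le_sup' (fun i : Fin K => euclNorm (M.mulVec (ω i))) (Finset.mem_univ i)
  have hbad : (Measure.pi fun _ : Fin K => G).real Sᶜ ≤ (α ^ K)⁻¹ :=
    calc (Measure.pi fun _ : Fin K => G).real Sᶜ
        ≤ (Measure.pi fun _ : Fin K => G).real (Set.univ.pi fun _ => B) := measureReal_mono hsub
      _ = G.real B ^ K := by simp [measureReal_def, Measure.pi_pi]
      _ ≤ α⁻¹ ^ K := by gcongr
      _ = (α ^ K)⁻¹ := inv_pow _ _
  have htot : 1 ≤ (Measure.pi fun _ : Fin K => G).real S +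
      (Measure.pi fun _ : Fin K => G).real Sᶜ := by
    simpa using measureReal_union_le (μ := Measure.pi fun _ : Fin K => G) S Sᶜ
  rw [← measureReal_def]
  linarith
end

section
/- Let F : ℝ^{m×n} → ℝ^{m×n}, let A : [0, h] → ℝ^{m×n} be differentiable with A′(t) = F(A(t)) for all t ∈ [0, h], and let Q ∈ ℝ^{m×k} have orthonormal columns (QᵀQ = I_k). Assume that for every t ∈ [0, h] the column space of A(t) is contained in the column space of Q. Then the curve L : [0, h] → ℝ^{n×k} defined by L(t) = A(t)ᵀ Q satisfies L(0) = A(0)ᵀ Q and L′(t) = F(Q L(t)ᵀ)ᵀ Q for all t ∈ [0, h]; that is, L is a solution of the C-step differential equation of the dynamical randomized SVD. -/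
open Matrix

attribute [local instance] Matrix.frobeniusNormedAddCommGroup Matrix.frobeniusNormedSpace

/-- A matrix `Q` with orthonormal columns projects onto its column space: `Q Qᵀ` fixes every
matrix whose column space is contained in that of `Q`. -/
theorem mul_transpose_mul_eq_self_of_range_le {R ι κ l : Type*} [CommRing R] [Fintype ι]
    [Fintype κ] [DecidableEq κ] [Fintype l] {Q : Matrix ι κ R} (hQ : Qᵀ * Q = 1)
    {M : Matrix ι l R} (hM : LinearMap.range M.mulVecLin ≤ LinearMap.range Q.mulVecLin) :
    Q * (Qᵀ * M) = M := by
  classical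
  refine Matrix.ext_of_mulVec_single fun j => ?_
  obtain ⟨w, hw⟩ := hM ⟨Pi.single j 1, rfl⟩
  simp only [Matrix.mulVecLin_apply] at hw
  rw [← Matrix.mulVec_mulVec, ← Matrix.mulVec_mulVec, ← hw, Matrix.mulVec_mulVec w, hQ,
    Matrix.one_mulVec]

/-- The linear map `X ↦ Xᵀ Q`. -/
def transposeMulLinearMap {R ι κ l : Type*} [CommSemiring R] [Fintype ι] (Q : Matrix ι κ R) :
    Matrix ι l R →ₗ[R] Matrix l κ R where
  toFun X := Xᵀ * Q
  map_add' X Y := by rw [Matrix.transpose_add, Matrix.add_mul]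
  map_smul' c X := by rw [Matrix.transpose_smul, Matrix.smul_mul, RingHom.id_apply]

/-- If `A′(t) = F(A(t))` on `[0, h]`, `Q` has orthonormal columns, and the column space
of `A(t)` is contained in the column space of `Q` for all `t ∈ [0, h]`, then
`L(t) = A(t)ᵀ Q` satisfies `L(0) = A(0)ᵀ Q` and `L′(t) = F(Q L(t)ᵀ)ᵀ Q`, i.e. `L`
solves the C-step differential equation of the dynamical randomized SVD. -/
theorem stmt_10 {m n k : ℕ} {h : ℝ}
    (F : Matrix (Fin m) (Fin n) ℝ → Matrix (Fin m) (Fin n) ℝ)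
    (A : ℝ → Matrix (Fin m) (Fin n) ℝ)
    (Q : Matrix (Fin m) (Fin k) ℝ) (hQ : Qᵀ * Q = 1)
    (hA : ∀ t ∈ Set.Icc (0 : ℝ) h, HasDerivAt A (F (A t)) t)
    (hrange : ∀ t ∈ Set.Icc (0 : ℝ) h,
      LinearMap.range (A t).mulVecLin ≤ LinearMap.range Q.mulVecLin) :
    (fun t => (A t)ᵀ * Q) 0 = (A 0)ᵀ * Q ∧
      ∀ t ∈ Set.Icc (0 : ℝ) h,
        HasDerivAt (fun t => (A t)ᵀ * Q) ((F (Q * ((A t)ᵀ * Q)ᵀ))ᵀ * Q) t := by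
  refine ⟨rfl, fun t ht => ?_⟩
  rw [Matrix.transpose_mul, Matrix.transpose_transpose,
    mul_transpose_mul_eq_self_of_range_le hQ (hrange t ht)]
  exact (LinearMap.toContinuousLinearMap (transposeMulLinearMap Q)).hasFDerivAt.comp_hasDerivAt t
    (hA t ht)
end
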